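/- arXiv:1403.8084 — 7 statements merged into one kernel-verified Lean document; each statement's English description precedes it below -/
import Mathlib

section
/- Let V ∈ ℝ^{d×d} be invertible, let ℓ, ℓ' ∈ ℝ^d, let ε ∈ ℝ^d have i.i.d. coordinates of law μ, and let Y₊, Y₋ be Markov kernels from ℝ^d to a measurable space 𝒴. Suppose the privacy condition holds simultaneously for bias vector ℓ and for bias vector ℓ': for every 𝐱 ∈ ℝ^d, the law of Y₊ at V𝐱 + ℓ + ε equals the law of Y₋ at V𝐱 − ℓ + ε, and the law of Y₊ at V𝐱 + ℓ' + ε equals the law of Y₋ at V𝐱 − ℓ' + ε. Then the obfuscation output is periodic in direction ℓ − ℓ': for every s ∈ ℝ^d, the law of Y₊ at s + 2(ℓ − ℓ') + ε equals the law of Y₊ at s + ε. -/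
open MeasureTheory ProbabilityTheory Matrix

/-- If the privacy condition holds simultaneously for two bias vectors
`ℓ` and `ℓ'`, then the obfuscation output law is periodic in direction `2(ℓ − ℓ')`:
the output law of `Y₊` at `s + 2(ℓ − ℓ') + ε` equals that of `Y₊` at `s + ε`. -/
theorem obfuscation_periodic
    {d : ℕ} {𝒴 : Type*} [MeasurableSpace 𝒴]
    (V : Matrix (Fin d) (Fin d) ℝ) (hV : IsUnit V)
    (ℓ ℓ' : Fin d → ℝ)
    (μ : Measure ℝ) [IsProbabilityMeasure μ]
    (Yp Ym : ProbabilityTheory.Kernel (Fin d → ℝ) 𝒴)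
    [IsMarkovKernel Yp] [IsMarkovKernel Ym]
    (hpriv : ∀ x : Fin d → ℝ,
      (Measure.pi fun _ : Fin d => μ).bind (fun e => Yp (V *ᵥ x + ℓ + e))
        = (Measure.pi fun _ : Fin d => μ).bind (fun e => Ym (V *ᵥ x - ℓ + e)))
    (hpriv' : ∀ x : Fin d → ℝ,
      (Measure.pi fun _ : Fin d => μ).bind (fun e => Yp (V *ᵥ x + ℓ' + e))
        = (Measure.pi fun _ : Fin d => μ).bind (fun e => Ym (V *ᵥ x - ℓ' + e))) :
    ∀ s : Fin d → ℝ,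
      (Measure.pi fun _ : Fin d => μ).bind
          (fun e => Yp (s + (2 : ℝ) • (ℓ - ℓ') + e))
        = (Measure.pi fun _ : Fin d => μ).bind (fun e => Yp (s + e)) := by
  intro s
  have hsurj : Function.Surjective V.mulVec := Matrix.mulVec_surjective_iff_isUnit.2 hV
  obtain ⟨x, hx⟩ := hsurj (s + (2 : ℝ) • (ℓ - ℓ') - ℓ)
  obtain ⟨x', hx'⟩ := hsurj (s - ℓ')
  have h := hpriv x
  have h' := hpriv' x'
  have hshift : s + (2 : ℝ) • (ℓ - ℓ') - ℓ - ℓ = s - ℓ' - ℓ' := by module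
  rw [hx, sub_add_cancel, hshift] at h
  rw [hx', sub_add_cancel] at h'
  exact h.trans h'.symm
end

section
/- Let 𝒴 be a measurable space and let (ν_𝐱)_{𝐱 ∈ ℝ^d} be a family of probability measures on 𝒴 (the law of the observation when the user profile is 𝐱), which is periodic in some direction: there exists w ∈ ℝ^d with w ≠ 0 such that ν_{𝐱 + w} = ν_𝐱 for all 𝐱 ∈ ℝ^d. Then for every randomized estimator, i.e., every Markov kernel κ from 𝒴 to ℝ^d, the worst-case expected squared ℓ₂ loss is infinite: sup_{𝐱 ∈ ℝ^d} ∫∫ ‖z − 𝐱‖₂² κ(y, dz) ν_𝐱(dy) = ∞. -/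
open MeasureTheory ProbabilityTheory

/-- If the observation laws at `x` and `x'` coincide, the risks of an estimator at these two
profiles add up to at least half of the squared distance in any single coordinate. -/
theorem ofReal_sq_sub_div_two_le_risk_add_risk
    {d : ℕ} {𝒴 : Type*} [MeasurableSpace 𝒴] (μ : Measure 𝒴) [IsProbabilityMeasure μ]
    (κ : Kernel 𝒴 (Fin d → ℝ)) [IsMarkovKernel κ] (x x' : Fin d → ℝ) (j : Fin d) :
    ENNReal.ofReal ((x' j - x j) ^ 2 / 2) ≤
      (∫⁻ y, ∫⁻ z, ENNReal.ofReal (∑ i, (z i - x i) ^ 2) ∂(κ y) ∂μ) +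
        ∫⁻ y, ∫⁻ z, ENNReal.ofReal (∑ i, (z i - x' i) ^ 2) ∂(κ y) ∂μ := by
  have hmeas (u : Fin d → ℝ) :
      Measurable fun z : Fin d → ℝ ↦ ENNReal.ofReal (∑ i, (z i - u i) ^ 2) := by
    fun_prop
  have hcoord (z u : Fin d → ℝ) : (z j - u j) ^ 2 ≤ ∑ i, (z i - u i) ^ 2 :=
    Finset.single_le_sum (f := fun i ↦ (z i - u i) ^ 2) (fun i _ ↦ sq_nonneg _)
      (Finset.mem_univ j)
  rw [← lintegral_add_left (hmeas x).lintegral_kernel]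
  simp_rw [← lintegral_add_left (hmeas x)]
  calc ENNReal.ofReal ((x' j - x j) ^ 2 / 2)
      = ∫⁻ y, ∫⁻ _, ENNReal.ofReal ((x' j - x j) ^ 2 / 2) ∂(κ y) ∂μ := by simp
    _ ≤ _ := by
      refine lintegral_mono fun y ↦ lintegral_mono fun z ↦ ?_
      rw [← ENNReal.ofReal_add (by positivity) (by positivity)]
      apply ENNReal.ofReal_le_ofReal
      nlinarith [hcoord z x, hcoord z x', sq_nonneg (z j - x j + (z j - x' j))]

/-- If the family of observation laws `(ν_𝐱)` is periodic in some
nonzero direction `w` (`ν_{𝐱+w} = ν_𝐱`), then every randomized estimator (Markov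
kernel `κ` from `𝒴` to `ℝ^d`) has infinite worst-case expected squared ℓ₂ loss. -/
theorem periodic_family_infinite_risk
    {d : ℕ} {𝒴 : Type*} [MeasurableSpace 𝒴]
    (ν : (Fin d → ℝ) → Measure 𝒴) (hprob : ∀ x, IsProbabilityMeasure (ν x))
    (w : Fin d → ℝ) (hw : w ≠ 0)
    (hper : ∀ x, ν (x + w) = ν x)
    (κ : ProbabilityTheory.Kernel 𝒴 (Fin d → ℝ)) [IsMarkovKernel κ] :
    (⨆ x : Fin d → ℝ,
        ∫⁻ y, ∫⁻ z, ENNReal.ofReal (∑ i, (z i - x i) ^ 2) ∂(κ y) ∂(ν x)) = ⊤ := by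
  obtain ⟨j, hj⟩ := Function.ne_iff.mp hw
  have hc : 0 < w j ^ 2 := sq_pos_of_ne_zero hj
  have hν (n : ℕ) : ν (n • w) = ν 0 := by
    simpa using Function.Periodic.nsmul hper n 0
  set R : (Fin d → ℝ) → ENNReal := fun x ↦
    ∫⁻ y, ∫⁻ z, ENNReal.ofReal (∑ i, (z i - x i) ^ 2) ∂(κ y) ∂(ν x) with hR
  have hsum (n : ℕ) : ENNReal.ofReal ((n * w j) ^ 2 / 2) ≤ (⨆ x, R x) + ⨆ x, R x := by
    have h := ofReal_sq_sub_div_two_le_risk_add_risk (ν 0) κ 0 (n • w) j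
    have h' : ENNReal.ofReal ((n * w j) ^ 2 / 2) ≤ R 0 + R (n • w) := by
      simp only [hR, hν]
      simpa using h
    exact h'.trans (add_le_add (le_iSup R 0) (le_iSup R (n • w)))
  suffices h : (⨆ x, R x) + ⨆ x, R x = ⊤ by simpa using h
  refine ENNReal.eq_top_of_forall_nnreal_le fun r ↦ ?_
  obtain ⟨n, hn⟩ := exists_nat_ge (2 * (r : ℝ) / w j ^ 2 + 1)
  refine le_trans ?_ (hsum n)
  rw [← ENNReal.ofReal_coe_nnreal]
  apply ENNReal.ofReal_le_ofReal
  have hr : 0 ≤ 2 * (r : ℝ) / w j ^ 2 := by positivity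
  have h1 : 2 * (r : ℝ) / w j ^ 2 ≤ (n : ℝ) ^ 2 := by nlinarith
  rw [div_le_iff₀ hc] at h1
  linarith [mul_pow (n : ℝ) (w j) 2]
end

section
/- (Core of Theorem 1.3: a privacy-preserving protocol compatible with two distinct bias vectors has infinite risk.) Let V ∈ ℝ^{d×d} be invertible, let ℓ, ℓ' ∈ ℝ^d with ℓ ≠ ℓ', let ε ∈ ℝ^d have i.i.d. coordinates of law μ, let 𝒴 be a measurable space, and let Y₊, Y₋ be Markov kernels from ℝ^d to 𝒴 satisfying the privacy condition simultaneously for bias vectors ℓ and ℓ': for every 𝐱 ∈ ℝ^d, the law of Y₊ at V𝐱 + ℓ + ε equals the law of Y₋ at V𝐱 − ℓ + ε, and likewise with ℓ replaced by ℓ'. Then for every randomized estimator κ (a Markov kernel from 𝒴 to ℝ^d), the worst-case risk under the true model with bias ℓ is infinite: sup_{𝐱 ∈ ℝ^d} ∫∫ ‖z − 𝐱‖₂² κ(y, dz) ν_𝐱(dy) = ∞, where ν_𝐱 is the law of Y₊ at V𝐱 + ℓ + ε. -/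
open MeasureTheory ProbabilityTheory Matrix

/-- Two quadratic losses centred at points that are far apart cannot both be small. -/
lemma half_sum_sq_sub_le {ι : Type*} [Fintype ι] (z a b : ι → ℝ) :
    (∑ i, (a i - b i) ^ 2) / 2 ≤ ∑ i, (z i - a i) ^ 2 + ∑ i, (z i - b i) ^ 2 := by
  rw [Finset.sum_div, ← Finset.sum_add_distrib]
  refine Finset.sum_le_sum fun i _ => ?_
  nlinarith [sq_nonneg ((z i - a i) + (z i - b i))]

/-- Two-point lower bound: the risks of an estimator at two parameters that induce the same law
sum to at least half the squared distance between these parameters. -/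
lemma ofReal_half_sum_sq_sub_le_risk_add_risk {ι 𝒴 : Type*} [Fintype ι] [MeasurableSpace 𝒴]
    (ν : Measure 𝒴) [IsProbabilityMeasure ν] (κ : ProbabilityTheory.Kernel 𝒴 (ι → ℝ))
    [IsMarkovKernel κ] (a b : ι → ℝ) :
    ENNReal.ofReal ((∑ i, (a i - b i) ^ 2) / 2) ≤
      ∫⁻ y, ∫⁻ z, ENNReal.ofReal (∑ i, (z i - a i) ^ 2) ∂(κ y) ∂ν +
      ∫⁻ y, ∫⁻ z, ENNReal.ofReal (∑ i, (z i - b i) ^ 2) ∂(κ y) ∂ν := by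
  have hm : Measurable fun z : ι → ℝ => ENNReal.ofReal (∑ i, (z i - a i) ^ 2) := by fun_prop
  rw [← lintegral_add_left hm.lintegral_kernel]
  calc ENNReal.ofReal ((∑ i, (a i - b i) ^ 2) / 2)
      = ∫⁻ y, ∫⁻ _, ENNReal.ofReal ((∑ i, (a i - b i) ^ 2) / 2) ∂(κ y) ∂ν := by simp
    _ ≤ _ := by
      refine lintegral_mono fun y => ?_
      beta_reduce
      rw [← lintegral_add_left hm]
      refine lintegral_mono fun z => ?_
      beta_reduce
      rw [← ENNReal.ofReal_add (by positivity) (by positivity)]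
      exact ENNReal.ofReal_le_ofReal (half_sum_sq_sub_le z a b)

/-- **core of Theorem 1.3.** If an obfuscation scheme `(Y₊, Y₋)` is
privacy preserving simultaneously for two distinct bias vectors `ℓ ≠ ℓ'` (with `V`
invertible), then every randomized estimator has infinite worst-case risk under the true
model with bias `ℓ`, where `ν_𝐱` is the law of `Y₊` at `V𝐱 + ℓ + ε`. -/
theorem two_bias_privacy_infinite_risk
    {d : ℕ} {𝒴 : Type*} [MeasurableSpace 𝒴]
    (V : Matrix (Fin d) (Fin d) ℝ) (hV : IsUnit V)
    (ℓ ℓ' : Fin d → ℝ) (hne : ℓ ≠ ℓ')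
    (μ : Measure ℝ) [IsProbabilityMeasure μ]
    (Yp Ym : ProbabilityTheory.Kernel (Fin d → ℝ) 𝒴)
    [IsMarkovKernel Yp] [IsMarkovKernel Ym]
    (hpriv : ∀ x : Fin d → ℝ,
      (Measure.pi fun _ : Fin d => μ).bind (fun e => Yp (V *ᵥ x + ℓ + e))
        = (Measure.pi fun _ : Fin d => μ).bind (fun e => Ym (V *ᵥ x - ℓ + e)))
    (hpriv' : ∀ x : Fin d → ℝ,
      (Measure.pi fun _ : Fin d => μ).bind (fun e => Yp (V *ᵥ x + ℓ' + e))
        = (Measure.pi fun _ : Fin d => μ).bind (fun e => Ym (V *ᵥ x - ℓ' + e)))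
    (κ : ProbabilityTheory.Kernel 𝒴 (Fin d → ℝ)) [IsMarkovKernel κ] :
    (⨆ x : Fin d → ℝ,
        ∫⁻ y, ∫⁻ z, ENNReal.ofReal (∑ i, (z i - x i) ^ 2) ∂(κ y)
          ∂((Measure.pi fun _ : Fin d => μ).bind (fun e => Yp (V *ᵥ x + ℓ + e)))) = ⊤ := by
  obtain ⟨v, hv⟩ : ∃ v : Fin d → ℝ, V *ᵥ v = ℓ' - ℓ :=
    ⟨V⁻¹ *ᵥ (ℓ' - ℓ), by
      rw [Matrix.mulVec_mulVec, Matrix.mul_nonsing_inv _ ((Matrix.isUnit_iff_isUnit_det V).1 hV),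
        Matrix.one_mulVec]⟩
  have hv0 : v ≠ 0 := by
    rintro rfl
    rw [Matrix.mulVec_zero] at hv
    exact hne (sub_eq_zero.1 hv.symm).symm
  set ν : (Fin d → ℝ) → Measure 𝒴 := fun x =>
    (Measure.pi fun _ : Fin d => μ).bind (fun e => Yp (V *ᵥ x + ℓ + e)) with hν
  have hprob : ∀ x, IsProbabilityMeasure (ν x) := fun x =>
    isProbabilityMeasure_bind (Yp.measurable.comp (measurable_const_add _)).aemeasurable
      (Filter.Eventually.of_forall fun _ => inferInstance)
  have hper : ∀ x, ν (x + (2 : ℝ) • v) = ν x := fun x => by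
    have h := hpriv' (x + v)
    have h₁ : V *ᵥ (x + v) + ℓ' = V *ᵥ (x + (2 : ℝ) • v) + ℓ := by
      rw [Matrix.mulVec_add, Matrix.mulVec_add, Matrix.mulVec_smul, hv]
      module
    have h₂ : V *ᵥ (x + v) - ℓ' = V *ᵥ x - ℓ := by
      rw [Matrix.mulVec_add, hv]
      module
    rw [h₁, h₂, ← hpriv x] at h
    exact h
  have hconst : ∀ n : ℕ, ν ((2 * n : ℝ) • v) = ν 0 := fun n => by
    induction n with
    | zero => simp
    | succ n ih =>
      rw [← ih, ← hper ((2 * n : ℝ) • v)]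
      congr 1
      push_cast
      module
  have hc : 0 < ∑ i, v i ^ 2 := by
    obtain ⟨i, hi⟩ := Function.ne_iff.1 hv0
    exact Finset.sum_pos' (fun _ _ => sq_nonneg _) ⟨i, Finset.mem_univ i, sq_pos_of_ne_zero hi⟩
  by_contra hfin
  set R : ENNReal := ⨆ x : Fin d → ℝ,
    ∫⁻ y, ∫⁻ z, ENNReal.ofReal (∑ i, (z i - x i) ^ 2) ∂(κ y) ∂(ν x) with hR
  have hle : ∀ x, ∫⁻ y, ∫⁻ z, ENNReal.ofReal (∑ i, (z i - x i) ^ 2) ∂(κ y) ∂(ν x) ≤ R :=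
    fun x => le_iSup (fun x : Fin d → ℝ =>
      ∫⁻ y, ∫⁻ z, ENNReal.ofReal (∑ i, (z i - x i) ^ 2) ∂(κ y) ∂(ν x)) x
  have hbound : ∀ n : ℕ, 2 * (n : ℝ) ^ 2 * ∑ i, v i ^ 2 ≤ (R + R).toReal := fun n => by
    have h := ofReal_half_sum_sq_sub_le_risk_add_risk (ν 0) κ ((2 * n : ℝ) • v) 0
    have hn := hle ((2 * n : ℝ) • v)
    rw [hconst n] at hn
    have h' := (ENNReal.ofReal_le_iff_le_toReal (ENNReal.add_ne_top.2 ⟨hfin, hfin⟩)).1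
      (h.trans (add_le_add hn (hle 0)))
    refine le_of_eq_of_le ?_ h'
    simp only [Pi.smul_apply, Pi.zero_apply, smul_eq_mul, sub_zero, mul_pow, ← Finset.mul_sum]
    ring
  obtain ⟨n, hn⟩ := exists_nat_gt ((R + R).toReal / ∑ i, v i ^ 2)
  rw [div_lt_iff₀ hc] at hn
  have hsq : (n : ℝ) ≤ 2 * (n : ℝ) ^ 2 := by
    have : (n : ℝ) ≤ (n : ℝ) ^ 2 := by exact_mod_cast Nat.le_self_pow two_ne_zero n
    nlinarith [sq_nonneg (n : ℝ)]
  exact absurd (hbound n) (not_le.2 (hn.trans_le (mul_le_mul_of_nonneg_right hsq hc.le)))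
end

section
/- (Theorem 1.2, maximal accuracy of the midpoint protocol: reduction.) Fix a finite set S, extended item profiles v_j = (v_{j0}, 𝐯_j) ∈ ℝ × ℝ^d for j ∈ S, and let ε = (ε_j)_{j∈S} have i.i.d. coordinates of law μ. Write ℓ = (v_{j0})_{j∈S} ∈ ℝ^S, and for 𝐱 ∈ ℝ^d let m(𝐱) = (⟨𝐯_j, 𝐱⟩)_{j∈S} ∈ ℝ^S. Let 𝒴 be a measurable space, let Y₊, Y₋ be Markov kernels from ℝ^S to 𝒴 satisfying the privacy condition (for every 𝐱, the law of Y₊ at m(𝐱) + ℓ + ε equals the law of Y₋ at m(𝐱) − ℓ + ε), and let κ be a Markov kernel from 𝒴 to ℝ^d (the protocol's estimator). Then there exists a Markov kernel κ'' from ℝ^S to ℝ^d such that for every x₀ ∈ {−1,+1} and every 𝐱 ∈ ℝ^d, the risk of κ'' on the midpoint-protocol output equals the risk of the given protocol: ∫∫ ‖z − 𝐱‖₂² κ''(y, dz) ν⁰_𝐱(dy) = ∫∫ ‖z − 𝐱‖₂² κ(y, dz) ν^{x₀}_𝐱(dy), where ν⁰_𝐱 is the law of m(𝐱) + ε and ν^{x₀}_𝐱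 is the law of Y_{x₀} at m(𝐱) + x₀ℓ + ε. Consequently, the worst-case risk of any privacy-preserving protocol is at least the minimax risk over randomized estimators operating directly on the midpoint-protocol output y = m(𝐱) + ε. -/
open MeasureTheory ProbabilityTheory

/-- **Theorem 1.2, reduction.** For any privacy-preserving obfuscation
scheme `(Y₊, Y₋)` and any randomized estimator `κ`, there exists a Markov kernel `κ''`
operating directly on the midpoint-protocol output `y = m(𝐱) + ε` whose risk at every
`𝐱` equals the risk of the given protocol, for both values `x₀ ∈ {-1,+1}` of the
private bit. -/
theorem midpoint_maximal_accuracy_reduction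
    {S : Type*} [Fintype S] {d : ℕ} {𝒴 : Type*} [MeasurableSpace 𝒴]
    (v0 : S → ℝ) (v : S → Fin d → ℝ)
    (μ : Measure ℝ) [IsProbabilityMeasure μ]
    (Yp Ym : ProbabilityTheory.Kernel (S → ℝ) 𝒴)
    [IsMarkovKernel Yp] [IsMarkovKernel Ym]
    (hpriv : ∀ x : Fin d → ℝ,
      (Measure.pi fun _ : S => μ).bind
          (fun e => Yp ((fun j => (∑ i, v j i * x i) + v0 j) + e))
        = (Measure.pi fun _ : S => μ).bind
          (fun e => Ym ((fun j => (∑ i, v j i * x i) - v0 j) + e)))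
    (κ : ProbabilityTheory.Kernel 𝒴 (Fin d → ℝ)) [IsMarkovKernel κ] :
    ∃ κ'' : ProbabilityTheory.Kernel (S → ℝ) (Fin d → ℝ), IsMarkovKernel κ'' ∧
      ∀ x₀ : ℝ, (x₀ = 1 ∨ x₀ = -1) → ∀ x : Fin d → ℝ,
        (∫⁻ y, ∫⁻ z, ENNReal.ofReal (∑ i, (z i - x i) ^ 2) ∂(κ'' y)
            ∂(Measure.map (fun e : S → ℝ => (fun j => ∑ i, v j i * x i) + e)
                (Measure.pi fun _ : S => μ)))
          = ∫⁻ y, ∫⁻ z, ENNReal.ofReal (∑ i, (z i - x i) ^ 2) ∂(κ y)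
              ∂((Measure.pi fun _ : S => μ).bind
                (fun e => (if x₀ = 1 then Yp else Ym)
                  ((fun j => (∑ i, v j i * x i) + x₀ * v0 j) + e))) := by
  have hshift : Measurable fun y : S → ℝ => y + v0 := by fun_prop
  refine ⟨κ ∘ₖ Yp.comap _ hshift, inferInstance, fun x₀ hx₀ x => ?_⟩
  have hlaw : ((Measure.pi fun _ : S => μ).bind fun e => (if x₀ = 1 then Yp else Ym)
        ((fun j => (∑ i, v j i * x i) + x₀ * v0 j) + e))
      = (Measure.pi fun _ : S => μ).bind
          (fun e => Yp ((fun j => (∑ i, v j i * x i) + v0 j) + e)) := by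
    rcases hx₀ with rfl | rfl
    · simp
    · rw [hpriv x]
      norm_num [← sub_eq_add_neg]
  have hloss : Measurable fun z : Fin d → ℝ => ENNReal.ofReal (∑ i, (z i - x i) ^ 2) := by
    fun_prop
  have hY : Measurable fun e : S → ℝ => Yp ((fun j => (∑ i, v j i * x i) + v0 j) + e) :=
    Yp.measurable.comp (by fun_prop)
  rw [hlaw, lintegral_map hloss.lintegral_kernel (by fun_prop),
    Measure.lintegral_bind hY.aemeasurable hloss.lintegral_kernel.aemeasurable]
  refine lintegral_congr fun e => ?_
  rw [Kernel.lintegral_comp _ _ _ hloss, Kernel.comap_apply]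
  congr 2
  ext j
  simp only [Pi.add_apply]
  ring
end

section
/- (Sub-sampled rated set is privacy preserving, eq. (13) of the paper.) Let S be a finite set and for each j ∈ S let p_j⁺, p_j⁻ ∈ (0, 1] be the rating probabilities of the two user types, with ratio ρ_j = p_j⁻ / p_j⁺. Fix x₀ ∈ {−1, +1} and write p_j^{x₀} for p_j⁺ if x₀ = +1 and p_j⁻ if x₀ = −1, and ρ_j^{x₀} for ρ_j if x₀ = +1 and ρ_j⁻¹ if x₀ = −1. Let S₀ be a random subset of S with independent memberships, P(j ∈ S₀) = p_j^{x₀}, and let S_R be obtained from S₀ by retaining each element j ∈ S₀ independently with probability min(1, ρ_j^{x₀}). Then S_R is a random subset of S with independent memberships and P(j ∈ S_R) = p_j^{x₀} · min(1, ρ_j^{x₀}) = min(p_j⁺, p_j⁻). In particular the law of S_R is the same for x₀ = +1 and x₀ = −1. -/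
open MeasureTheory ProbabilityTheory

theorem ProbabilityTheory.iIndepSet.inter_sumElim {ι Ω : Type*} [MeasurableSpace Ω]
    {P : Measure Ω} {A B : ι → Set Ω} (hA : ∀ i, MeasurableSet (A i))
    (hB : ∀ i, MeasurableSet (B i)) (h : iIndepSet (Sum.elim A B) P) :
    (∀ i, P (A i ∩ B i) = P (A i) * P (B i)) ∧ iIndepSet (fun i => A i ∩ B i) P := by
  have hfin : ∀ s : Finset ι, P (⋂ i ∈ s, A i ∩ B i) = ∏ i ∈ s, P (A i) * P (B i) := by
    intro s
    have hset : (⋂ i ∈ s, A i ∩ B i) = ⋂ i ∈ s.disjSum s, Sum.elim A B i := by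
      ext ω
      simp [forall_and]
    rw [hset, h.meas_biInter, Finset.prod_disjSum,
      Finset.prod_mul_distrib]
    rfl
  have hmul : ∀ i, P (A i ∩ B i) = P (A i) * P (B i) := fun i => by simpa using hfin {i}
  refine ⟨hmul, (iIndepSet_iff_meas_biInter fun i => (hA i).inter (hB i)).2 fun s => ?_⟩
  simpa only [hmul] using hfin s

theorem mul_min_one_div {x y : ℝ} (hx : 0 < x) : x * min 1 (y / x) = min x y := by
  rw [mul_min_of_nonneg _ _ hx.le, mul_one, mul_div_cancel₀ y hx.ne']

/-- **eq. (13): sub-sampled rated set is privacy preserving.** If a user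
of type `x₀` rates items independently with probabilities `p^{x₀}` (membership
indicators `a`), and retains rated items independently with probabilities
`min(1, ρ^{x₀})` (indicators `b`), all events being jointly independent, then the
revealed set `S_R` (indicators `a ∧ b`) has independent memberships with
`P(j ∈ S_R) = p_j^{x₀}·min(1, ρ_j^{x₀}) = min(p_j⁺, p_j⁻)`; in particular the law of
`S_R` does not depend on `x₀`. -/
theorem subsampled_set_privacy
    {S : Type*} [Fintype S]
    {Ω : Type*} [MeasurableSpace Ω] (P : Measure Ω) [IsProbabilityMeasure P]
    (pp pm : S → ℝ)
    (hpp : ∀ j, pp j ∈ Set.Ioc (0 : ℝ) 1) (hpm : ∀ j, pm j ∈ Set.Ioc (0 : ℝ) 1)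
    (ρ : S → ℝ) (hρ : ∀ j, ρ j = pm j / pp j)
    (x₀ : ℝ) (hx₀ : x₀ = 1 ∨ x₀ = -1)
    (px ρx : S → ℝ)
    (hpx : px = if x₀ = 1 then pp else pm)
    (hρx : ρx = if x₀ = 1 then ρ else fun j => (ρ j)⁻¹)
    (a b : Ω → S → Bool)
    (hma : ∀ j, Measurable fun ω => a ω j) (hmb : ∀ j, Measurable fun ω => b ω j)
    (hindep : iIndepSet
      (fun i : S ⊕ S =>
        Sum.elim (fun j => {ω | a ω j = true}) (fun j => {ω | b ω j = true}) i) P)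
    (hmema : ∀ j, P {ω | a ω j = true} = ENNReal.ofReal (px j))
    (hmemb : ∀ j, P {ω | b ω j = true} = ENNReal.ofReal (min 1 (ρx j))) :
    iIndepSet (fun j : S => {ω | (a ω j && b ω j) = true}) P ∧
    (∀ j, P {ω | (a ω j && b ω j) = true} = ENNReal.ofReal (px j * min 1 (ρx j))) ∧
    (∀ j, px j * min 1 (ρx j) = min (pp j) (pm j)) := by
  have hmA : ∀ j, MeasurableSet {ω | a ω j = true} := fun j =>
    hma j (measurableSet_singleton true)
  have hmB : ∀ j, MeasurableSet {ω | b ω j = true} := fun j =>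
    hmb j (measurableSet_singleton true)
  have hset : ∀ j, {ω | (a ω j && b ω j) = true} = {ω | a ω j = true} ∩ {ω | b ω j = true} := by
    intro j
    ext ω
    simp
  obtain ⟨hmul, hind⟩ := iIndepSet.inter_sumElim hmA hmB hindep
  have hpx_nonneg : ∀ j, 0 ≤ px j := by
    intro j
    rw [hpx]
    split_ifs
    exacts [(hpp j).1.le, (hpm j).1.le]
  refine ⟨by simpa only [hset] using hind, fun j => ?_, fun j => ?_⟩
  · rw [hset, hmul, hmema, hmemb, ENNReal.ofReal_mul (hpx_nonneg j)]
  · subst hpx hρx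
    split_ifs
    · rw [hρ, mul_min_one_div (hpp j).1]
    · simp only [hρ, inv_div]
      rw [mul_min_one_div (hpm j).1, min_comm]
end

section
/- (Maximal expected size of the revealed set.) Let S be a finite set and p_j⁺, p_j⁻ ∈ [0,1] for j ∈ S. Suppose for each x₀ ∈ {−1,+1} random subsets A_{x₀} ⊆ B_{x₀} ⊆ S satisfy P(j ∈ B_{x₀}) = p_j^{x₀} and the law of A_{+1} equals the law of A_{−1}. Then the expected number of revealed items satisfies E[|A_{+1}|] ≤ Σ_{j∈S} min(p_j⁺, p_j⁻), and this upper bound is exactly the expected size of the set revealed by the midpoint protocol with sub-sampling, whose revealed set S_R has independent memberships with P(j ∈ S_R) = min(p_j⁺, p_j⁻). -/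
open MeasureTheory ProbabilityTheory

/-- The expected size of a random subset is the sum of its membership probabilities. -/
theorem integral_sum_ite_eq_sum_measureReal {S Ω : Type*} [Fintype S] [MeasurableSpace Ω]
    (P : Measure Ω) [IsFiniteMeasure P] (A : Ω → S → Bool)
    (hA : ∀ j, Measurable fun ω => A ω j) :
    ∫ ω, (∑ j, if A ω j = true then (1 : ℝ) else 0) ∂P = ∑ j, P.real {ω | A ω j = true} := by
  have hset : ∀ j, MeasurableSet {ω | A ω j = true} := fun j =>
    hA j (measurableSet_singleton true)
  have hind : ∀ j, (fun ω => if A ω j = true then (1 : ℝ) else 0) =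
      {ω | A ω j = true}.indicator 1 := fun j => by
    ext ω
    simp [Set.indicator_apply]
  rw [integral_finsetSum]
  · refine Finset.sum_congr rfl fun j _ => ?_
    rw [hind j, integral_indicator_one (hset j)]
  · intro j _
    rw [hind j]
    exact (integrable_const (1 : ℝ)).indicator (hset j)

/-- **maximal expected size of the revealed set.** Under the hypotheses
of the previous lemma, the expected number of revealed items satisfies
`E[|A_{+1}|] ≤ ∑_j min(p_j⁺, p_j⁻)`, and this bound is exactly the expected size of the
MPSS revealed set `S_R`, which has independent memberships with
`P(j ∈ S_R) = min(p_j⁺, p_j⁻)`. -/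
theorem maximal_expected_revealed_size
    {S : Type*} [Fintype S]
    {Ω : Type*} [MeasurableSpace Ω] (P : Measure Ω) [IsProbabilityMeasure P]
    (pp pm : S → ℝ)
    (hpp : ∀ j, pp j ∈ Set.Icc (0 : ℝ) 1) (hpm : ∀ j, pm j ∈ Set.Icc (0 : ℝ) 1)
    (Bp Bm Ap Am : Ω → S → Bool)
    (hmAp : Measurable Ap) (hmAm : Measurable Am)
    (hsubp : ∀ᵐ ω ∂P, ∀ j, Ap ω j = true → Bp ω j = true)
    (hsubm : ∀ᵐ ω ∂P, ∀ j, Am ω j = true → Bm ω j = true)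
    (hBp : ∀ j, P {ω | Bp ω j = true} = ENNReal.ofReal (pp j))
    (hBm : ∀ j, P {ω | Bm ω j = true} = ENNReal.ofReal (pm j))
    (hpriv : Measure.map Ap P = Measure.map Am P)
    (SR : Ω → S → Bool)
    (hmSR : ∀ j, Measurable fun ω => SR ω j)
    (hSRindep : iIndepSet (fun j : S => {ω | SR ω j = true}) P)
    (hSRmem : ∀ j, P {ω | SR ω j = true} = ENNReal.ofReal (min (pp j) (pm j))) :
    (∫ ω, (∑ j, if Ap ω j = true then (1 : ℝ) else 0) ∂P ≤ ∑ j, min (pp j) (pm j)) ∧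
    (∫ ω, (∑ j, if SR ω j = true then (1 : ℝ) else 0) ∂P = ∑ j, min (pp j) (pm j)) := by
  have hle : ∀ (A B : Ω → S → Bool) (p : S → ℝ), (∀ j, p j ∈ Set.Icc (0 : ℝ) 1) →
      (∀ᵐ ω ∂P, ∀ j, A ω j = true → B ω j = true) →
      (∀ j, P {ω | B ω j = true} = ENNReal.ofReal (p j)) →
      ∀ j, P.real {ω | A ω j = true} ≤ p j := by
    intro A B p hp hsub hB j
    refine ENNReal.toReal_le_of_le_ofReal (hp j).1 ?_
    rw [← hB j]
    exact measure_mono_ae (hsub.mono fun ω hω => hω j)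
  have heq : ∀ j, P.real {ω | Ap ω j = true} = P.real {ω | Am ω j = true} := by
    intro j
    have hs : MeasurableSet {a : S → Bool | a j = true} :=
      measurableSet_eq_fun (measurable_pi_apply j) measurable_const
    have h := congrArg (fun μ => μ.real {a : S → Bool | a j = true}) hpriv
    simp only [map_measureReal_apply hmAp hs, map_measureReal_apply hmAm hs] at h
    exact h
  constructor
  · rw [integral_sum_ite_eq_sum_measureReal P Ap fun j => hmAp.eval]
    refine Finset.sum_le_sum fun j _ => le_min (hle Ap Bp pp hpp hsubp hBp j) ?_
    rw [heq j]
    exact hle Am Bm pm hpm hsubm hBm j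
  · rw [integral_sum_ite_eq_sum_measureReal P SR hmSR]
    refine Finset.sum_congr rfl fun j _ => ?_
    rw [measureReal_def, hSRmem j, ENNReal.toReal_ofReal (le_min (hpp j).1 (hpm j).1)]
end

section
/- (Lemma: stochastic domination of any privacy-preserving PNI selection by MPSS.) Let S be a finite set with p_j⁺, p_j⁻ ∈ (0,1] for j ∈ S; partition S into S⁺ = {j : p_j⁻ ≤ p_j⁺} and S⁻ = {j : p_j⁻ > p_j⁺}. For each x₀ ∈ {−1,+1}, let κ_{x₀} be a Markov kernel from the power set of S to the power set of S such that κ_{x₀}(B) is supported on subsets of B for every B ⊆ S (the protocol's selection rule), and let A_{x₀} be the resulting random revealed set when the input B is a random subset with independent memberships P(j ∈ B) = p_j^{x₀}. Assume: (privacy) the law of A_{+1} equals the law of A_{−1}; and (positive–negative independence) A_{+1} ∩ S⁺ and A_{+1} ∩ S⁻ are independent random sets. Let S_R denote the MPSS revealed set, i.e., a random subset of S with independent memberships P(j ∈ S_R) = min(p_j⁺, p_j⁻). Then there exists a coupling: a probability measure π on (power set of S) × (power set of S) whose first marginal is the law of A_{+1}, whose second marginal is the law of S_R, and such that π({(a,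 b) : a ⊆ b}) = 1. -/
open MeasureTheory ProbabilityTheory

/-- The Bernoulli measure on `Bool` giving mass `t` to `true` and `1 - t` to `false`
(for `t ∈ [0,1]`). -/
noncomputable def bern (t : ℝ) : Measure Bool :=
  ENNReal.ofReal t • Measure.dirac true + ENNReal.ofReal (1 - t) • Measure.dirac false

section Helpers

theorem isProbabilityMeasure_bern {t : ℝ} (ht : t ∈ Set.Ioc (0 : ℝ) 1) :
    IsProbabilityMeasure (bern t) := by
  refine ⟨?_⟩
  simp only [bern, Measure.add_apply, Measure.smul_apply, measure_univ, smul_eq_mul, mul_one]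
  rw [← ENNReal.ofReal_add ht.1.le (by linarith [ht.2])]
  simp

/-- The configuration that agrees with `x` on the coordinates satisfying `c`, and with `y` on
the others. -/
def splice {S β : Type*} (c : S → Prop) [DecidablePred c] (x y : S → β) : S → β :=
  fun j => if c j then x j else y j

theorem map_splice_pi {S β : Type*} [Fintype S] [MeasurableSpace β] (c : S → Prop)
    [DecidablePred c] (μ ν : S → Measure β) [∀ j, IsProbabilityMeasure (μ j)]
    [∀ j, IsProbabilityMeasure (ν j)] :
    ((Measure.pi μ).prod (Measure.pi ν)).map (fun q => splice c q.1 q.2) =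
      Measure.pi (fun j => if c j then μ j else ν j) := by
  have hmeas : Measurable (fun q : (S → β) × (S → β) => splice c q.1 q.2) := by
    refine measurable_pi_lambda _ fun j => ?_
    by_cases h : c j <;> simp only [splice, h, if_true, if_false] <;> fun_prop
  have (j : S) : IsProbabilityMeasure (if c j then μ j else ν j) := by
    split_ifs <;> infer_instance
  symm
  refine Measure.pi_eq fun s hs => ?_
  have hpre : (fun q : (S → β) × (S → β) => splice c q.1 q.2) ⁻¹' (Set.univ.pi s) =
      (Set.univ.pi fun j => if c j then s j else Set.univ) ×ˢ
        (Set.univ.pi fun j => if c j then Set.univ else s j) := by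
    ext q
    simp only [Set.mem_preimage, Set.mem_prod, Set.mem_univ_pi, splice, ← forall_and]
    refine forall_congr' fun j => ?_
    by_cases h : c j <;> simp [h]
  rw [Measure.map_apply hmeas (MeasurableSet.univ_pi hs), hpre, Measure.prod_prod,
    Measure.pi_pi, Measure.pi_pi, ← Finset.prod_mul_distrib]
  refine Finset.prod_congr rfl fun j _ => ?_
  by_cases h : c j <;> simp [h]

theorem map_splice_prod_self {S : Type*} [Fintype S] (c : S → Prop) [DecidablePred c]
    (α : Measure (S → Bool)) [IsProbabilityMeasure α]
    (h : IndepFun (fun A : S → Bool => fun j : S => if c j then A j else false)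
      (fun A : S → Bool => fun j : S => if c j then false else A j) α) :
    (α.prod α).map (fun q => splice c q.1 q.2) = α := by
  set f : (S → Bool) → S → Bool := fun A j => if c j then A j else false
  set g : (S → Bool) → S → Bool := fun A j => if c j then false else A j
  have hf : Measurable f := measurable_of_finite f
  have hg : Measurable g := measurable_of_finite g
  have hsplice : Measurable (fun q : (S → Bool) × (S → Bool) => splice c q.1 q.2) :=
    measurable_of_finite _
  have hfactor : (fun q : (S → Bool) × (S → Bool) => splice c q.1 q.2) =
      (fun q => splice c q.1 q.2) ∘ Prod.map f g := by
    ext q j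
    by_cases hj : c j <;> simp [splice, f, g, hj]
  have hid : (fun q : (S → Bool) × (S → Bool) => splice c q.1 q.2) ∘ (fun A => (f A, g A)) =
      id := by
    ext A j
    by_cases hj : c j <;> simp [splice, f, g, hj]
  rw [hfactor, ← Measure.map_map hsplice (hf.prodMap hg), ← Measure.map_prod_map α α hf hg,
    ← (indepFun_iff_map_prod_eq_prod_map_map hf.aemeasurable hg.aemeasurable).1 h,
    Measure.map_map hsplice (hf.prodMk hg), hid, Measure.map_id]

theorem ae_compProd_subset {S : Type*} [Finite S] (μ : Measure (S → Bool)) [SFinite μ]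
    (κ : Kernel (S → Bool) (S → Bool)) [IsMarkovKernel κ]
    (hsupp : ∀ B : S → Bool, κ B {C | ∀ j, C j = true → B j = true} = 1) :
    ∀ᵐ q ∂(μ ⊗ₘ κ), ∀ j, q.2 j = true → q.1 j = true := by
  refine (Measure.ae_compProd_iff (Set.toFinite _).measurableSet).2 (ae_of_all _ fun B => ?_)
  exact (prob_compl_eq_zero_iff (Set.toFinite _).measurableSet).2 (hsupp B)

end Helpers

/-- **stochastic domination of privacy-preserving PNI selections by
MPSS.** Let `κ_{x₀}` be a Markov selection kernel supported on subsets of its input,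
applied to a rated set with independent memberships of probabilities `p^{x₀}`, yielding
the revealed-set law `α_{x₀}`. If the protocol is privacy preserving (`α_{+1} = α_{−1}`)
and positive–negative independent, then the revealed set of the protocol is dominated by
the MPSS revealed set (independent memberships with probabilities `min(p⁺, p⁻)`): there
is a coupling `π` of `α_{+1}` and the MPSS law concentrated on pairs `(a, b)` with
`a ⊆ b`. -/
theorem pni_selection_dominated_by_mpss
    {S : Type*} [Fintype S]
    (pp pm : S → ℝ)
    (hpp : ∀ j, pp j ∈ Set.Ioc (0 : ℝ) 1) (hpm : ∀ j, pm j ∈ Set.Ioc (0 : ℝ) 1)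
    (κp κm : ProbabilityTheory.Kernel (S → Bool) (S → Bool))
    [IsMarkovKernel κp] [IsMarkovKernel κm]
    (hsuppp : ∀ B : S → Bool, κp B {C | ∀ j, C j = true → B j = true} = 1)
    (hsuppm : ∀ B : S → Bool, κm B {C | ∀ j, C j = true → B j = true} = 1)
    (αp αm : Measure (S → Bool))
    (hαp : αp = (Measure.pi fun j => bern (pp j)).bind (fun B => κp B))
    (hαm : αm = (Measure.pi fun j => bern (pm j)).bind (fun B => κm B))
    (hpriv : αp = αm)
    (hPNI : IndepFun
      (fun A : S → Bool => fun j : S => if pm j ≤ pp j then A j else false)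
      (fun A : S → Bool => fun j : S => if pm j ≤ pp j then false else A j) αp) :
    ∃ π : Measure ((S → Bool) × (S → Bool)), IsProbabilityMeasure π ∧
      π.map Prod.fst = αp ∧
      π.map Prod.snd = Measure.pi (fun j => bern (min (pp j) (pm j))) ∧
      π {q | ∀ j, q.1 j = true → q.2 j = true} = 1 := by
  have (j : S) := isProbabilityMeasure_bern (hpp j)
  have (j : S) := isProbabilityMeasure_bern (hpm j)
  set μp := Measure.pi fun j => bern (pp j) with hμp
  set μm := Measure.pi fun j => bern (pm j) with hμm
  set c : S → Prop := fun j => pm j ≤ pp j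
  let _ : DecidablePred c := fun j => Real.decidableLE (pm j) (pp j)
  have hsnd_p : (μp ⊗ₘ κp).map Prod.snd = αp := by rw [hαp]; exact Measure.snd_compProd μp κp
  have hsnd_m : (μm ⊗ₘ κm).map Prod.snd = αp := by
    rw [hpriv, hαm]; exact Measure.snd_compProd μm κm
  have hfst_p : (μp ⊗ₘ κp).map Prod.fst = μp := Measure.fst_compProd μp κp
  have hfst_m : (μm ⊗ₘ κm).map Prod.fst = μm := Measure.fst_compProd μm κm
  have : IsProbabilityMeasure αp := by
    rw [← hsnd_p]; exact Measure.isProbabilityMeasure_map measurable_snd.aemeasurable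
  let ρ := (μm ⊗ₘ κm).prod (μp ⊗ₘ κp)
  let F : ((S → Bool) × (S → Bool)) × ((S → Bool) × (S → Bool)) → (S → Bool) × (S → Bool) :=
    fun q => (splice c q.1.2 q.2.2, splice c q.1.1 q.2.1)
  have hF : Measurable F := measurable_of_finite F
  have hsplice : Measurable (fun q : (S → Bool) × (S → Bool) => splice c q.1 q.2) :=
    measurable_of_finite _
  refine ⟨ρ.map F, Measure.isProbabilityMeasure_map hF.aemeasurable, ?_, ?_, ?_⟩
  · rw [Measure.map_map measurable_fst hF]
    change ρ.map ((fun q => splice c q.1 q.2) ∘ Prod.map Prod.snd Prod.snd) = αp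
    rw [← Measure.map_map hsplice (measurable_snd.prodMap measurable_snd),
      ← Measure.map_prod_map _ _ measurable_snd measurable_snd, hsnd_m, hsnd_p]
    exact map_splice_prod_self c αp hPNI
  · rw [Measure.map_map measurable_snd hF]
    change ρ.map ((fun q => splice c q.1 q.2) ∘ Prod.map Prod.fst Prod.fst) = _
    rw [← Measure.map_map hsplice (measurable_fst.prodMap measurable_fst),
      ← Measure.map_prod_map _ _ measurable_fst measurable_fst, hfst_m, hfst_p,
      hμm, hμp, map_splice_pi]
    congr 1
    ext1 j
    by_cases h : c j
    · rw [if_pos h, min_eq_right h]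
    · rw [if_neg h, min_eq_left (not_le.1 h).le]
  · rw [Measure.map_apply hF (Set.toFinite _).measurableSet]
    refine (prob_compl_eq_zero_iff (Set.toFinite _).measurableSet).1 ?_
    have hm : ∀ᵐ q ∂ρ, ∀ j, q.1.2 j = true → q.1.1 j = true :=
      Measure.quasiMeasurePreserving_fst.ae (ae_compProd_subset μm κm hsuppm)
    have hp : ∀ᵐ q ∂ρ, ∀ j, q.2.2 j = true → q.2.1 j = true :=
      Measure.quasiMeasurePreserving_snd.ae (ae_compProd_subset μp κp hsuppp)
    change ∀ᵐ q ∂ρ, ∀ j, (F q).1 j = true → (F q).2 j = true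
    filter_upwards [hm, hp] with q hqm hqp j
    by_cases h : c j
    · simpa [F, splice, h] using hqm j
    · simpa [F, splice, h] using hqp j
end
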